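/- Let d ≥ 3 and let S be a finite set of unit vectors in ℂ^d containing two linearly independent, nonorthogonal vectors a and b. Suppose S admits at least one KS assignment, some KS assignment f of S has f(a) = 1, and every KS assignment f of S satisfies f(a) + f(b) ≤ 1 (i.e., S is a nontrivial true-implies-false set between a and b). Then S contains at least d + 5 vectors. -/

import Mathlib

open BigOperators Finset Matrix

/-- A KS assignment for a finite set `S` of vectors in `ℂ^d`: a 0/1 assignment such that
(I) no two orthogonal vectors of `S` are both assigned 1, and (II) among any `d` mutually
orthogonal vectors of `S` at least one is assigned 1. -/
def IsKSAssignment (d : ℕ) (S : Finset (Fin d → ℂ)) (f : (Fin d → ℂ) → ℕ) : Prop :=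
  (∀ u ∈ S, f u = 0 ∨ f u = 1) ∧
  (∀ u ∈ S, ∀ w ∈ S, star u ⬝ᵥ w = 0 → ¬(f u = 1 ∧ f w = 1)) ∧
  (∀ b : Fin d → (Fin d → ℂ), (∀ k, b k ∈ S) →
    (∀ k l, k ≠ l → star (b k) ⬝ᵥ b l = 0) → ∃ k, f (b k) = 1)

/-- A finite set of vectors in `ℂ^d` is an orthonormal basis. -/
structure IsOrthoBasis {d : ℕ} (Q : Finset (Fin d → ℂ)) : Prop where
  card_eq : Q.card = d
  unit : ∀ u ∈ Q, star u ⬝ᵥ u = 1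
  ortho : ∀ u ∈ Q, ∀ w ∈ Q, u ≠ w → star u ⬝ᵥ w = 0

theorem star_dotProduct_eq_zero_comm {d : ℕ} {u w : Fin d → ℂ} :
    star u ⬝ᵥ w = 0 ↔ star w ⬝ᵥ u = 0 := by
  rw [Matrix.star_dotProduct, star_eq_zero]

theorem sum_star_dotProduct_smul_of_orthonormal {d : ℕ} (e : Fin d → Fin d → ℂ)
    (h : ∀ i j, star (e i) ⬝ᵥ e j = if i = j then 1 else 0) (x : Fin d → ℂ) :
    ∑ k, (star (e k) ⬝ᵥ x) • e k = x := by
  let M : Matrix (Fin d) (Fin d) ℂ := Matrix.of fun i => star (e i)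
  have hM : M * Mᴴ = 1 := by
    ext i j
    rw [Matrix.one_apply, ← h i j]
    simp [M, Matrix.mul_apply, dotProduct]
  rw [mul_eq_one_comm] at hM
  conv_rhs => rw [← Matrix.one_mulVec x, ← hM, ← Matrix.mulVec_mulVec]
  ext i
  simp only [Finset.sum_apply, Pi.smul_apply, smul_eq_mul, Matrix.mulVec, dotProduct, M,
    Matrix.conjTranspose_apply, Matrix.of_apply, Pi.star_apply, star_star]
  exact Finset.sum_congr rfl fun k _ => mul_comm _ _

namespace IsOrthoBasis

variable {d : ℕ} {Q Q' : Finset (Fin d → ℂ)}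

theorem sum_smul (hQ : IsOrthoBasis Q) (x : Fin d → ℂ) :
    ∑ v ∈ Q, (star v ⬝ᵥ x) • v = x := by
  let e := (Q.equivFinOfCardEq hQ.card_eq).symm
  have h : ∀ i j, star (e i).1 ⬝ᵥ (e j).1 = if i = j then 1 else 0 := by
    intro i j
    split_ifs with hij
    · subst hij
      exact hQ.unit _ (e i).2
    · exact hQ.ortho _ (e i).2 _ (e j).2 fun h => hij (e.injective (Subtype.ext h))
  rw [← Finset.sum_coe_sort Q, ← e.sum_comp]
  exact sum_star_dotProduct_smul_of_orthonormal (fun i => (e i).1) h x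

/-- An orthonormal basis contains a vector orthogonal to neither of two nonorthogonal vectors. -/
theorem exists_nonorthogonal (hQ : IsOrthoBasis Q) {a b : Fin d → ℂ} (hab : star a ⬝ᵥ b ≠ 0) :
    ∃ v ∈ Q, star a ⬝ᵥ v ≠ 0 ∧ star b ⬝ᵥ v ≠ 0 := by
  by_contra! h
  apply hab
  rw [← hQ.sum_smul b, dotProduct_sum]
  refine Finset.sum_eq_zero fun v hv => ?_
  rw [dotProduct_smul, smul_eq_mul]
  by_cases hav : star a ⬝ᵥ v = 0
  · rw [hav, mul_zero]
  · rw [star_dotProduct_eq_zero_comm.1 (h v hv hav), zero_mul]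

/-- A vector orthogonal to all but one vector `v` of an orthonormal basis is parallel to `v`. -/
theorem eq_smul_of_forall_ne (hQ : IsOrthoBasis Q) {v x : Fin d → ℂ} (hv : v ∈ Q)
    (h : ∀ w ∈ Q, w ≠ v → star w ⬝ᵥ x = 0) : x = (star v ⬝ᵥ x) • v := by
  conv_lhs => rw [← hQ.sum_smul x]
  exact Finset.sum_eq_single_of_mem v hv fun w hw hwv => by rw [h w hw hwv, zero_smul]

/-- If `Q'` has at most two vectors outside `Q` and none of its vectors is parallel to `x ∈ Q`,
then every vector of `Q \ Q'` is nonorthogonal to every vector of `Q' \ Q`. -/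
theorem nonorthogonal_of_sdiff (hQ : IsOrthoBasis Q) (hQ' : IsOrthoBasis Q')
    (hcard : (Q' \ Q).card ≤ 2) {x : Fin d → ℂ} (hx : x ∈ Q)
    (hpar : ∀ v ∈ Q', ∀ c : ℂ, v ≠ c • x) {u v : Fin d → ℂ} (hu : u ∈ Q \ Q')
    (hv : v ∈ Q' \ Q) : star u ⬝ᵥ v ≠ 0 := by
  have hxQ' : x ∉ Q' := fun h => hpar x h 1 (one_smul _ _).symm
  have hcard' : (Q \ Q').card ≤ 2 := by
    rwa [Finset.card_sdiff_comm (hQ.card_eq.trans hQ'.card_eq.symm)]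
  have hx0 : x ≠ 0 := by
    rintro rfl
    simpa using hQ.unit 0 hx
  rw [Finset.mem_sdiff] at hu hv
  -- every vector of `Q' \ Q` is nonorthogonal to `x`
  have key : ∀ w ∈ Q' \ Q, star x ⬝ᵥ w ≠ 0 := by
    intro w hw hxw
    obtain ⟨v', hv', hv'x, -⟩ := hQ'.exists_nonorthogonal (a := x) (b := x)
      (by rw [hQ.unit x hx]; exact one_ne_zero)
    have hv'Q : v' ∉ Q := fun h =>
      hv'x (hQ.ortho x hx v' h fun h' => hxQ' (h' ▸ hv'))
    have hx_eq := hQ'.eq_smul_of_forall_ne (x := x) hv' fun z hz hzv' => by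
      rw [star_dotProduct_eq_zero_comm]
      by_contra hxz
      have hzQ : z ∉ Q := fun h => hxz (hQ.ortho x hx z h fun h' => hxQ' (h' ▸ hz))
      have hzw : z ≠ w := fun h => hxz (h ▸ hxw)
      have hv'w : v' ≠ w := fun h => hv'x (h ▸ hxw)
      have hsub : ({z, v', w} : Finset (Fin d → ℂ)) ⊆ Q' \ Q := by
        simp only [Finset.insert_subset_iff, Finset.singleton_subset_iff]
        exact ⟨Finset.mem_sdiff.2 ⟨hz, hzQ⟩, Finset.mem_sdiff.2 ⟨hv', hv'Q⟩, hw⟩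
      have h3 := Finset.card_le_card hsub
      rw [Finset.card_eq_three.2 ⟨z, v', w, hzv', hzw, hv'w, rfl⟩] at h3
      omega
    have hc : star v' ⬝ᵥ x ≠ 0 := fun h => hv'x (star_dotProduct_eq_zero_comm.1 h)
    refine hpar v' hv' (star v' ⬝ᵥ x)⁻¹ ?_
    rw [eq_inv_smul_iff₀ hc]
    exact hx_eq.symm
  intro huv
  have hux : u ≠ x := fun h => key v (Finset.mem_sdiff.2 hv) (h ▸ huv)
  refine hpar v hv.1 (star x ⬝ᵥ v) (hQ.eq_smul_of_forall_ne hx fun z hz hzx => ?_)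
  by_contra hzv
  have hzQ' : z ∉ Q' := fun h => hzv (hQ'.ortho z h v hv.1 fun h' => hv.2 (h' ▸ hz))
  have hzu : z ≠ u := fun h => hzv (h ▸ huv)
  have hsub : ({z, u, x} : Finset (Fin d → ℂ)) ⊆ Q \ Q' := by
    simp only [Finset.insert_subset_iff, Finset.singleton_subset_iff]
    exact ⟨Finset.mem_sdiff.2 ⟨hz, hzQ'⟩, Finset.mem_sdiff.2 hu, Finset.mem_sdiff.2 ⟨hx, hxQ'⟩⟩
  have h3 := Finset.card_le_card hsub
  rw [Finset.card_eq_three.2 ⟨z, u, x, hzu, hzx, hux, rfl⟩] at h3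
  omega

theorem eq_of_subset (hQ : IsOrthoBasis Q) (hQ' : IsOrthoBasis Q') (h : Q ⊆ Q') : Q = Q' :=
  Finset.eq_of_subset_of_card_le h (by rw [hQ.card_eq, hQ'.card_eq])

end IsOrthoBasis

/-- Among at most `d + 2` vectors, all orthonormal bases can be hit by pairwise nonorthogonal
vectors that are also nonorthogonal to two given nonorthogonal vectors. -/
theorem exists_pairwise_nonorthogonal_hitting {d : ℕ} {V : Finset (Fin d → ℂ)}
    (hV : V.card ≤ d + 2) {a b : Fin d → ℂ} (hab : star a ⬝ᵥ b ≠ 0) :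
    ∃ T : Set (Fin d → ℂ), (∀ u ∈ T, star a ⬝ᵥ u ≠ 0 ∧ star b ⬝ᵥ u ≠ 0) ∧
      (∀ u ∈ T, ∀ w ∈ T, star u ⬝ᵥ w ≠ 0) ∧
      ∀ Q ⊆ V, IsOrthoBasis Q → ∃ u ∈ Q, u ∈ T := by
  by_cases hne : ∃ Q ⊆ V, IsOrthoBasis Q
  swap
  · exact ⟨∅, by simp, by simp, fun Q hQV hQ => (hne ⟨Q, hQV, hQ⟩).elim⟩
  obtain ⟨Q, hQV, hQ⟩ := hne
  obtain ⟨x, hx, hax, hbx⟩ := hQ.exists_nonorthogonal hab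
  have hxx := hQ.unit x hx
  by_cases hall : ∀ Q' ⊆ V, IsOrthoBasis Q' → ∃ v ∈ Q', ∃ c : ℂ, v = c • x
  · refine ⟨{v | ∃ c : ℂ, c ≠ 0 ∧ v = c • x}, ?_, ?_, fun Q' hQ'V hQ' => ?_⟩
    · rintro _ ⟨c, hc, rfl⟩
      simp [hc, hax, hbx]
    · rintro _ ⟨c, hc, rfl⟩ _ ⟨c', hc', rfl⟩
      simp [hc, hc', hxx]
    · obtain ⟨v, hv, c, rfl⟩ := hall Q' hQ'V hQ'
      refine ⟨_, hv, c, ?_, rfl⟩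
      rintro rfl
      simpa using hQ'.unit _ hv
  push Not at hall
  obtain ⟨Q', hQ'V, hQ', hpar⟩ := hall
  have hxQ' : x ∉ Q' := fun h => hpar x h 1 (one_smul _ _).symm
  have hun := Finset.card_le_card (Finset.union_subset hQ'V hQV)
  have hsd := Finset.card_sdiff_add_card Q' Q
  rw [hQ.card_eq] at hsd
  have hcard : (Q' \ Q).card ≤ 2 := by omega
  have hnon : ∀ u ∈ Q \ Q', ∀ v ∈ Q' \ Q, star u ⬝ᵥ v ≠ 0 := fun u hu v hv =>
    hQ.nonorthogonal_of_sdiff hQ' hcard hx hpar hu hv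
  obtain ⟨y, hy, hay, hby⟩ := hQ'.exists_nonorthogonal hab
  have hyy := hQ'.unit y hy
  -- there are no bases other than `Q` and `Q'`
  have htwo : ∀ R ⊆ V, IsOrthoBasis R → R = Q ∨ R = Q' := by
    intro R hRV hR
    have hxsd : x ∈ Q \ Q' := Finset.mem_sdiff.2 ⟨hx, hxQ'⟩
    have hcard2 : 2 ≤ (Q' \ Q).card := by
      by_contra! hlt
      have hle : (Q \ Q').card ≤ 1 := by
        rw [Finset.card_sdiff_comm (hQ.card_eq.trans hQ'.card_eq.symm)]
        omega
      obtain ⟨v, hv, hvQ⟩ := Finset.not_subset.1 fun hs =>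
        hxQ' (hQ'.eq_of_subset hQ hs ▸ hx)
      refine hpar v hv (star x ⬝ᵥ v) (hQ.eq_smul_of_forall_ne hx fun z hz hzx => ?_)
      have hzQ' : z ∈ Q' := by
        by_contra h
        exact hzx (Finset.card_le_one.1 hle z (Finset.mem_sdiff.2 ⟨hz, h⟩) x hxsd)
      exact hQ'.ortho z hzQ' v hv fun h => hvQ (h ▸ hz)
    have hVeq : Q' ∪ Q = V := Finset.eq_of_subset_of_card_le
      (Finset.union_subset hQ'V hQV) (by omega)
    by_contra! h
    obtain ⟨u, huR, huQ⟩ := Finset.not_subset.1 fun hs => h.1 (hR.eq_of_subset hQ hs)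
    obtain ⟨w, hwR, hwQ'⟩ := Finset.not_subset.1 fun hs => h.2 (hR.eq_of_subset hQ' hs)
    have huQ' : u ∈ Q' := by
      have := hRV huR
      rw [← hVeq, Finset.mem_union] at this
      tauto
    have hwQ : w ∈ Q := by
      have := hRV hwR
      rw [← hVeq, Finset.mem_union] at this
      tauto
    exact hnon w (Finset.mem_sdiff.2 ⟨hwQ, hwQ'⟩) u (Finset.mem_sdiff.2 ⟨huQ', huQ⟩)
      (hR.ortho w hwR u huR fun h' => huQ (h' ▸ hwQ))
  by_cases hxy : star x ⬝ᵥ y = 0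
  · have hyQ : y ∈ Q := by
      by_contra h
      exact hnon x (Finset.mem_sdiff.2 ⟨hx, hxQ'⟩) y (Finset.mem_sdiff.2 ⟨hy, h⟩) hxy
    refine ⟨{y}, by simp [hay, hby], by simp [hyy], fun R hRV hR => ⟨y, ?_, rfl⟩⟩
    rcases htwo R hRV hR with rfl | rfl <;> assumption
  · have hyx : star y ⬝ᵥ x ≠ 0 := fun h => hxy (star_dotProduct_eq_zero_comm.1 h)
    refine ⟨{x, y}, by simp [hax, hbx, hay, hby], by simp [hxx, hyy, hxy, hyx],
      fun R hRV hR => ?_⟩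
    rcases htwo R hRV hR with rfl | rfl
    · exact ⟨x, hx, by simp⟩
    · exact ⟨y, hy, by simp⟩

/-- Let `d ≥ 3` and let `S` be a finite set of unit vectors in `ℂ^d`
containing two linearly independent, nonorthogonal vectors `a` and `b`. If `S` admits a
KS assignment, some KS assignment assigns `1` to `a`, and every KS assignment `f` of `S`
satisfies `f a + f b ≤ 1` (so `S` is a nontrivial true-implies-false set between `a` and
`b`), then `S` contains at least `d + 5` vectors. -/
theorem statement15 (d : ℕ) (hd : 3 ≤ d)
    (S : Finset (Fin d → ℂ))
    (hunit : ∀ x ∈ S, star x ⬝ᵥ x = (1 : ℂ))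
    (a b : Fin d → ℂ) (haS : a ∈ S) (hbS : b ∈ S)
    (hli : LinearIndependent ℂ ![a, b])
    (hnonorth : star a ⬝ᵥ b ≠ 0)
    (hexists : ∃ f : (Fin d → ℂ) → ℕ, IsKSAssignment d S f)
    (hexists1 : ∃ f : (Fin d → ℂ) → ℕ, IsKSAssignment d S f ∧ f a = 1)
    (hTIFS : ∀ f : (Fin d → ℂ) → ℕ, IsKSAssignment d S f → f a + f b ≤ 1) :
    d + 5 ≤ S.card := by
  classical
  by_contra! hlt
  have hne : a ≠ b := fun h => by
    have := hli.injective.ne (show (0 : Fin 2) ≠ 1 by decide)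
    simp [h] at this
  have hV : ((S.erase a).erase b).card ≤ d + 2 := by
    rw [Finset.card_erase_of_mem (Finset.mem_erase.2 ⟨hne.symm, hbS⟩),
      Finset.card_erase_of_mem haS]
    omega
  obtain ⟨T, hT, hTT, hhit⟩ := exists_pairwise_nonorthogonal_hitting hV hnonorth
  have hba : star b ⬝ᵥ a ≠ 0 := fun h => hnonorth (star_dotProduct_eq_zero_comm.1 h)
  have hT' : ∀ u ∈ T, star u ⬝ᵥ a ≠ 0 ∧ star u ⬝ᵥ b ≠ 0 := fun u hu =>
    ⟨fun h => (hT u hu).1 (star_dotProduct_eq_zero_comm.1 h),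
      fun h => (hT u hu).2 (star_dotProduct_eq_zero_comm.1 h)⟩
  let f : (Fin d → ℂ) → ℕ := fun u => if u = a ∨ u = b ∨ u ∈ T then 1 else 0
  have hf : ∀ u, f u = 1 ↔ u = a ∨ u = b ∨ u ∈ T := fun u => by
    simp only [f]
    split_ifs with h <;> simp [h]
  have hKS : IsKSAssignment d S f := by
    refine ⟨fun u _ => ?_, fun u _ w _ huw => ?_, fun e he horth => ?_⟩
    · simp only [f]
      split_ifs <;> simp
    · rw [hf, hf]
      rintro ⟨rfl | rfl | hu, rfl | rfl | hw⟩
      · simp [hunit _ haS] at huw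
      · exact hnonorth huw
      · exact (hT w hw).1 huw
      · exact hba huw
      · simp [hunit _ hbS] at huw
      · exact (hT w hw).2 huw
      · exact (hT' u hu).1 huw
      · exact (hT' u hu).2 huw
      · exact hTT u hu w hw huw
    · simp only [hf]
      by_contra! h
      have hinj : Function.Injective e := fun k l hkl => by
        by_contra hne
        have := horth k l hne
        rw [hkl, hunit _ (he l)] at this
        exact one_ne_zero this
      have hQ : IsOrthoBasis (Finset.univ.image e) := by
        refine ⟨?_, ?_, ?_⟩
        · rw [Finset.card_image_of_injective _ hinj, Finset.card_univ, Fintype.card_fin]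
        · simp only [Finset.mem_image, Finset.mem_univ, true_and]
          rintro _ ⟨k, rfl⟩
          exact hunit _ (he k)
        · simp only [Finset.mem_image, Finset.mem_univ, true_and]
          rintro _ ⟨k, rfl⟩ _ ⟨l, rfl⟩ hkl
          exact horth k l fun h => hkl (h ▸ rfl)
      obtain ⟨u, hu, huT⟩ := hhit _ (fun u hu => by
        obtain ⟨k, -, rfl⟩ := Finset.mem_image.1 hu
        simp [h k, he k]) hQ
      obtain ⟨k, -, rfl⟩ := Finset.mem_image.1 hu
      exact (h k).2.2 huT
  have h2 := hTIFS f hKS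
  rw [(hf a).2 (Or.inl rfl), (hf b).2 (Or.inr (Or.inl rfl))] at h2
  omega
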